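/- Let d ≥ 1 and σ > 0 be fixed, let π be the standard Gaussian density on ℝ^d, q(x,y) = (2πσ²)^{−d/2}·exp(−‖y−x‖²/(2σ²)), and take the globally balanced weights w(x,y) = π(y)/π(x). Let P_n denote the corresponding Multiple-try Metropolis kernel with n proposals, and let Φ(P_n) denote its conductance. Then Φ(P_n) → 0 as n → ∞. -/

import Mathlib

open MeasureTheory ENNReal Filter

noncomputable section

/-- `ℝ^d` with the Euclidean norm and Lebesgue measure. -/
abbrev Ed (d : ℕ) := EuclideanSpace ℝ (Fin d)

variable {d : ℕ}

/-- The standard Gaussian density on `ℝ^d`. -/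
def stdGauss (d : ℕ) (x : Ed d) : ℝ :=
  (2 * Real.pi) ^ (-(d : ℝ) / 2) * Real.exp (-‖x‖ ^ 2 / 2)

/-- The Gaussian random-walk proposal density `q(x,y)` with scale `σ`. -/
def rwDens (σ : ℝ) (x y : Ed d) : ℝ :=
  (2 * Real.pi * σ ^ 2) ^ (-(d : ℝ) / 2) * Real.exp (-‖y - x‖ ^ 2 / (2 * σ ^ 2))

/-- The globally balanced weights `w(x,y) = π(y)/π(x)`. -/
def gbWeight (d : ℕ) (x y : Ed d) : ℝ := stdGauss d y / stdGauss d x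

/-- `r(x,y) = (π(y) q(y,x) w(y,x)) / (π(x) q(x,y) w(x,y))`. -/
def accRatio (σ : ℝ) (x y : Ed d) : ℝ :=
  (stdGauss d y * rwDens σ y x * gbWeight d y x) /
    (stdGauss d x * rwDens σ x y * gbWeight d x y)

/-- Off-diagonal transition density of the globally balanced Multiple-try
Metropolis kernel `Pₙ`. -/
def pMTM (d : ℕ) (σ : ℝ) (n : ℕ) (x y : Ed d) : ℝ :=
  rwDens σ x y * gbWeight d x y *
    ∫ ys : Fin (n - 1) → Ed d, ∫ zs : Fin (n - 1) → Ed d,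
      min ((n : ℝ) / (gbWeight d x y + ∑ i, gbWeight d x (ys i)))
          (accRatio σ x y * n / (gbWeight d y x + ∑ i, gbWeight d y (zs i))) *
        ((∏ i, rwDens σ x (ys i)) * ∏ i, rwDens σ y (zs i))

/-- The conductance `Φ(P)` of a `π`-invariant kernel with off-diagonal density
`p`, where `π` is the probability density of the target. -/
def conductance (pi : Ed d → ℝ) (p : Ed d → Ed d → ℝ) : ℝ≥0∞ :=
  ⨅ (A : Set (Ed d)) (_ : MeasurableSet A ∧
      0 < (∫⁻ x in A, ENNReal.ofReal (pi x)) ∧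
      (∫⁻ x in A, ENNReal.ofReal (pi x)) ≤ 1 / 2),
    (∫⁻ x in A, ∫⁻ y in Aᶜ, ENNReal.ofReal (p x y * pi x)) /
      ∫⁻ x in A, ENNReal.ofReal (pi x)

lemma gbWeight_eq_exp (x y : Ed d) :
    gbWeight d x y = Real.exp ((‖x‖ ^ 2 - ‖y‖ ^ 2) / 2) := by
  have h : (0 : ℝ) < (2 * Real.pi) ^ (-(d : ℝ) / 2) := by positivity
  rw [gbWeight, stdGauss, stdGauss, mul_div_mul_left _ _ h.ne', ← Real.exp_sub]
  congr 1
  ring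

lemma gbWeight_pos (x y : Ed d) : 0 < gbWeight d x y := by
  rw [gbWeight_eq_exp]
  exact Real.exp_pos _

lemma stdGauss_pos (x : Ed d) : 0 < stdGauss d x := by
  unfold stdGauss
  positivity

lemma continuous_stdGauss : Continuous (stdGauss d) := by
  unfold stdGauss
  fun_prop

lemma continuous_gbWeight (x : Ed d) : Continuous (gbWeight d x) :=
  continuous_stdGauss.div_const _

lemma continuous_rwDens (σ : ℝ) (x : Ed d) : Continuous (rwDens σ x) := by
  unfold rwDens
  fun_prop

lemma rwDens_pos {σ : ℝ} (hσ : 0 < σ) (x y : Ed d) : 0 < rwDens σ x y := by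
  unfold rwDens
  positivity

lemma rwDens_comm (σ : ℝ) (x y : Ed d) : rwDens σ x y = rwDens σ y x := by
  simp only [rwDens, norm_sub_rev]

lemma rwDens_eq_sub (σ : ℝ) (x y : Ed d) : rwDens σ x y = rwDens σ 0 (y - x) := by
  simp [rwDens]

lemma accRatio_eq_inv {σ : ℝ} (hσ : 0 < σ) (x y : Ed d) :
    accRatio σ x y = (gbWeight d x y)⁻¹ := by
  have h1 := (stdGauss_pos x).ne'
  have h2 := (stdGauss_pos y).ne'
  have h3 := (rwDens_pos hσ y x).ne'
  rw [accRatio, gbWeight, gbWeight, rwDens_comm σ x y]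
  field_simp

lemma integrable_exp_neg_mul_norm_sq {b : ℝ} (hb : 0 < b) :
    Integrable (fun v : Ed d => Real.exp (-b * ‖v‖ ^ 2)) := by
  have h := GaussianFourier.integral_rexp_neg_mul_sq_norm (V := Ed d) hb
  refine Integrable.of_integral_ne_zero ?_
  rw [h]
  positivity

lemma rwDens_zero_eq (σ : ℝ) (v : Ed d) :
    rwDens σ 0 v = (2 * Real.pi * σ ^ 2) ^ (-(d : ℝ) / 2) *
      Real.exp (-(1 / (2 * σ ^ 2)) * ‖v‖ ^ 2) := by
  rw [rwDens, sub_zero]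
  congr 2
  ring

lemma integrable_rwDens {σ : ℝ} (hσ : 0 < σ) (x : Ed d) : Integrable (rwDens σ x) := by
  have h : Integrable (rwDens σ (0 : Ed d)) := by
    simp only [funext (rwDens_zero_eq (d := d) σ)]
    exact (integrable_exp_neg_mul_norm_sq (by positivity)).const_mul _
  simpa only [← rwDens_eq_sub] using h.comp_sub_right x

lemma integral_rwDens {σ : ℝ} (hσ : 0 < σ) (x : Ed d) : ∫ y, rwDens σ x y = 1 := by
  simp only [rwDens_eq_sub σ x]
  rw [integral_sub_right_eq_self (rwDens σ (0 : Ed d)) x]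
  simp only [rwDens_zero_eq, integral_const_mul]
  rw [GaussianFourier.integral_rexp_neg_mul_sq_norm (by positivity), finrank_euclideanSpace_fin,
    show Real.pi / (1 / (2 * σ ^ 2)) = 2 * Real.pi * σ ^ 2 by field_simp, neg_div,
    ← Real.rpow_add (by positivity), neg_add_cancel, Real.rpow_zero]

lemma integrable_rwDens_mul_exp_norm {σ : ℝ} (hσ : 0 < σ) :
    Integrable (fun v : Ed d => rwDens σ 0 v * Real.exp ‖v‖) := by
  refine Integrable.mono' (((integrable_exp_neg_mul_norm_sq (d := d)
    (b := 1 / (4 * σ ^ 2)) (by positivity)).const_mul (Real.exp (σ ^ 2))).const_mul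
    ((2 * Real.pi * σ ^ 2) ^ (-(d : ℝ) / 2)))
    (((continuous_rwDens σ 0).mul (by fun_prop)).aestronglyMeasurable) (.of_forall fun v => ?_)
  rw [Real.norm_of_nonneg (mul_nonneg (rwDens_pos hσ _ _).le (Real.exp_pos _).le),
    rwDens_zero_eq, mul_assoc, ← Real.exp_add, ← Real.exp_add]
  refine mul_le_mul_of_nonneg_left (Real.exp_le_exp.mpr ?_) (by positivity)
  have h : σ ^ 2 + -(1 / (4 * σ ^ 2)) * ‖v‖ ^ 2 - (-(1 / (2 * σ ^ 2)) * ‖v‖ ^ 2 + ‖v‖)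
      = (σ - ‖v‖ / (2 * σ)) ^ 2 := by
    field_simp
    ring
  linarith [sq_nonneg (σ - ‖v‖ / (2 * σ))]

/-- Moving from `y` a distance `2` towards the origin reaches a unit ball on which the weight
`w(y, ·)` is at least `exp (‖y‖ - 5)`. -/
lemma exists_ball_exp_le_gbWeight (y : Ed d) :
    ∃ c : Ed d, ‖c - y‖ ≤ 2 ∧
      ∀ z ∈ Metric.ball c 1, Real.exp (‖y‖ - 5) ≤ gbWeight d y z := by
  obtain ⟨c, hc, hcy⟩ : ∃ c : Ed d, ‖c - y‖ ≤ 2 ∧ ‖c‖ ≤ |‖y‖ - 2| := by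
    rcases eq_or_ne y 0 with rfl | hy
    · exact ⟨0, by simp, by simp⟩
    · have hy' : ‖y‖ ≠ 0 := norm_ne_zero_iff.mpr hy
      refine ⟨(1 - 2 / ‖y‖) • y, ?_, ?_⟩
      · rw [sub_smul, one_smul, sub_sub_cancel_left, norm_neg, norm_smul, Real.norm_of_nonneg
          (by positivity), div_mul_cancel₀ _ hy']
      · rw [norm_smul, Real.norm_eq_abs, ← abs_of_nonneg (norm_nonneg y), ← abs_mul,
          abs_of_nonneg (norm_nonneg y), sub_mul, div_mul_cancel₀ _ hy', one_mul]
  refine ⟨c, hc, fun z hz => ?_⟩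
  rw [gbWeight_eq_exp, Real.exp_le_exp]
  rw [mem_ball_iff_norm] at hz
  have h1 : ‖z‖ ≤ |‖y‖ - 2| + 1 := by
    have := norm_le_norm_add_norm_sub' z c
    linarith
  have h2 : ‖z‖ ^ 2 ≤ (|‖y‖ - 2| + 1) ^ 2 := by gcongr
  have h3 := norm_nonneg y
  rcases abs_cases (‖y‖ - 2) with ⟨h, -⟩ | ⟨h, -⟩ <;> rw [h] at h2 <;> nlinarith

/-- A uniform bound on the Laplace transform of the rescaled weights of the proposals. -/
lemma exists_integral_exp_neg_gbWeight_le (d : ℕ) {σ : ℝ} (hσ : 0 < σ) :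
    ∃ κ : ℝ, 0 < κ ∧ ∀ y : Ed d,
      Integrable (fun z => Real.exp (-(gbWeight d y z / Real.exp (‖y‖ - 5))) * rwDens σ y z) ∧
      ∫ z, Real.exp (-(gbWeight d y z / Real.exp (‖y‖ - 5))) * rwDens σ y z ≤ Real.exp (-κ) := by
  set m : ℝ := (2 * Real.pi * σ ^ 2) ^ (-(d : ℝ) / 2) * Real.exp (-3 ^ 2 / (2 * σ ^ 2)) with hm
  have hm0 : 0 < m := by positivity
  have hvol : 0 < volume.real (Metric.ball (0 : Ed d) 1) :=
    ENNReal.toReal_pos (Metric.measure_ball_pos _ _ one_pos).ne' measure_ball_lt_top.ne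
  refine ⟨volume.real (Metric.ball (0 : Ed d) 1) * (1 / 2 * m), by positivity, fun y => ?_⟩
  set t := Real.exp (‖y‖ - 5)
  have ht : 0 < t := Real.exp_pos _
  set f : Ed d → ℝ := fun z => Real.exp (-(gbWeight d y z / t)) * rwDens σ y z
  have hfle : ∀ z, f z ≤ rwDens σ y z := fun z => by
    refine mul_le_of_le_one_left (rwDens_pos hσ _ _).le (Real.exp_le_one_iff.mpr ?_)
    have := gbWeight_pos y z
    rw [neg_nonpos]
    positivity
  have hf : Integrable f := by
    refine (integrable_rwDens hσ y).mono' (Continuous.aestronglyMeasurable ?_)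
      (.of_forall fun z => ?_)
    · have := continuous_gbWeight y
      have := continuous_rwDens σ y
      fun_prop
    · rw [Real.norm_of_nonneg (mul_nonneg (Real.exp_pos _).le (rwDens_pos hσ _ _).le)]
      exact hfle z
  refine ⟨hf, ?_⟩
  obtain ⟨c, hc, hcw⟩ := exists_ball_exp_le_gbWeight y
  have hint : Integrable (fun z => rwDens σ y z - f z) := (integrable_rwDens hσ y).sub hf
  have key : volume.real (Metric.ball (0 : Ed d) 1) * (1 / 2 * m)
      ≤ ∫ z, (rwDens σ y z - f z) := by
    calc volume.real (Metric.ball (0 : Ed d) 1) * (1 / 2 * m)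
        = ∫ _ in Metric.ball c 1, 1 / 2 * m := by
          rw [setIntegral_const, smul_eq_mul, measureReal_def, measureReal_def,
            Measure.addHaar_ball_center volume c]
      _ ≤ ∫ z in Metric.ball c 1, (rwDens σ y z - f z) := by
          refine setIntegral_mono_on (integrableOn_const measure_ball_lt_top.ne)
            hint.integrableOn measurableSet_ball fun z hz => ?_
          have h1 : Real.exp (-(gbWeight d y z / t)) ≤ 1 / 2 := by
            have h : 1 ≤ gbWeight d y z / t := (one_le_div ht).mpr (hcw z hz)
            calc Real.exp (-(gbWeight d y z / t)) ≤ Real.exp (-1) := by gcongr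
              _ ≤ 1 / 2 := by
                have := Real.exp_neg_one_lt_d9
                linarith
          have h2 : m ≤ rwDens σ y z := by
            rw [hm, rwDens]
            have h3 : ‖z - y‖ ≤ 3 := by
              have := norm_sub_le_norm_sub_add_norm_sub z c y
              rw [mem_ball_iff_norm] at hz
              linarith
            gcongr
          have h3 : Real.exp (-(gbWeight d y z / t)) * rwDens σ y z ≤ 1 / 2 * rwDens σ y z :=
            mul_le_mul_of_nonneg_right h1 (hm0.le.trans h2)
          change _ ≤ rwDens σ y z - Real.exp (-(gbWeight d y z / t)) * rwDens σ y z
          linarith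
      _ ≤ ∫ z, (rwDens σ y z - f z) :=
          setIntegral_le_integral hint (.of_forall fun z => sub_nonneg.mpr (hfle z))
  rw [integral_sub (integrable_rwDens hσ y) hf, integral_rwDens hσ] at key
  have := Real.add_one_le_exp (-(volume.real (Metric.ball (0 : Ed d) 1) * (1 / 2 * m)))
  linarith

/-- Either the sum `S` of the competing weights is of order `t * M`, or the exponential factor
`exp (κ M / 2 - S / t)` is at least one. -/
lemma min_div_le {w w' S n t κ M T : ℝ} (hw : 0 < w) (hw' : 0 < w') (hn : 0 ≤ n)
    (ht : 0 < t) (hκ : 0 < κ) (hM : 0 < M) (hnM : n ≤ 2 * M) (hT : 0 ≤ T) :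
    min (n / (w + T)) (w⁻¹ * n / (w' + S)) ≤
      w⁻¹ * (4 / (κ * t) + n * Real.exp (κ * M / 2) * Real.exp (-(S / t))) := by
  rcases le_total (t * (κ * M / 2)) S with h | h
  · refine (min_le_right _ _).trans ?_
    rw [mul_div_assoc]
    gcongr
    calc n / (w' + S) ≤ 2 * M / (t * (κ * M / 2)) := by
          gcongr
          linarith
      _ = 4 / (κ * t) := by
          field_simp
          norm_num
      _ ≤ _ := le_add_of_nonneg_right (by positivity)
  · refine (min_le_left _ _).trans ?_
    rw [mul_assoc, ← Real.exp_add]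
    have h1 : 1 ≤ Real.exp (κ * M / 2 + -(S / t)) := by
      rw [Real.one_le_exp_iff, ← sub_eq_add_neg, sub_nonneg, div_le_iff₀ ht]
      linarith
    calc n / (w + T) ≤ n / w := by
          gcongr
          linarith
      _ = w⁻¹ * (n * 1) := by ring
      _ ≤ w⁻¹ * (n * Real.exp (κ * M / 2 + -(S / t))) := by gcongr
      _ ≤ _ := by
          gcongr
          exact le_add_of_nonneg_left (by positivity)

lemma exists_pMTM_le (d : ℕ) {σ : ℝ} (hσ : 0 < σ) :
    ∃ κ C : ℝ, 0 < κ ∧ 0 ≤ C ∧ ∀ n : ℕ, 2 ≤ n → ∀ x y : Ed d,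
      pMTM d σ n x y ≤
        rwDens σ x y * (C * Real.exp (-‖y‖) + n * Real.exp (-(κ * (n - 1 : ℕ)))) := by
  obtain ⟨κ, hκ, H⟩ := exists_integral_exp_neg_gbWeight_le d hσ
  refine ⟨κ / 2, 4 / κ * Real.exp 5, by positivity, by positivity, fun n hn x y => ?_⟩
  obtain ⟨Hi, Hle⟩ := H y
  set t := Real.exp (‖y‖ - 5) with ht_def
  have ht : 0 < t := Real.exp_pos _
  set M : ℝ := ((n - 1 : ℕ) : ℝ) with hM_def
  have hM : 0 < M := by
    rw [hM_def]
    exact_mod_cast (by omega : 0 < n - 1)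
  have hnM : (n : ℝ) ≤ 2 * M := by
    rw [hM_def]
    exact_mod_cast (by omega : n ≤ 2 * (n - 1))
  set w := gbWeight d x y
  have hw : 0 < w := gbWeight_pos x y
  have hq : ∀ a b : Ed d, 0 ≤ rwDens σ a b := fun a b => (rwDens_pos hσ a b).le
  have hW : ∀ a b : Ed d, 0 ≤ gbWeight d a b := fun a b => (gbWeight_pos a b).le
  set K := 4 / (κ * t) + n * Real.exp (-(κ / 2 * M))
  set F : (Fin (n - 1) → Ed d) → (Fin (n - 1) → Ed d) → ℝ := fun ys zs =>
      min ((n : ℝ) / (w + ∑ i, gbWeight d x (ys i)))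
          (accRatio σ x y * n / (gbWeight d y x + ∑ i, gbWeight d y (zs i))) *
        ((∏ i, rwDens σ x (ys i)) * ∏ i, rwDens σ y (zs i))
  have hF0 : ∀ ys zs, 0 ≤ F ys zs := fun ys zs => by
    refine mul_nonneg (le_min ?_ ?_) (mul_nonneg (Finset.prod_nonneg fun i _ => hq _ _)
      (Finset.prod_nonneg fun i _ => hq _ _))
    · exact div_nonneg (by positivity) (add_nonneg hw.le (Finset.sum_nonneg fun i _ => hW _ _))
    · rw [accRatio_eq_inv hσ]
      exact div_nonneg (mul_nonneg (inv_nonneg.mpr hw.le) (by positivity))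
        (add_nonneg (hW _ _) (Finset.sum_nonneg fun i _ => hW _ _))
  have hinner : ∀ ys, ∫ zs, F ys zs ≤ w⁻¹ * K * ∏ i, rwDens σ x (ys i) := fun ys => by
    have i1 : Integrable (fun zs : Fin (n - 1) → Ed d => ∏ i, rwDens σ y (zs i)) :=
      Integrable.fintype_prod fun _ => integrable_rwDens hσ y
    have i2 : Integrable (fun zs : Fin (n - 1) → Ed d =>
        ∏ i, (Real.exp (-(gbWeight d y (zs i) / t)) * rwDens σ y (zs i))) :=
      Integrable.fintype_prod fun _ => Hi
    have hQ : 0 ≤ ∏ i, rwDens σ x (ys i) := Finset.prod_nonneg fun i _ => hq _ _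
    calc ∫ zs, F ys zs
        ≤ ∫ zs : Fin (n - 1) → Ed d, (w⁻¹ * ∏ i, rwDens σ x (ys i)) *
          (4 / (κ * t) * (∏ i, rwDens σ y (zs i)) + n * Real.exp (κ * M / 2) *
            ∏ i, (Real.exp (-(gbWeight d y (zs i) / t)) * rwDens σ y (zs i))) := by
          refine integral_mono_of_nonneg (.of_forall (hF0 ys))
            (((i1.const_mul _).add (i2.const_mul _)).const_mul _) (.of_forall fun zs => ?_)
          have hZ : 0 ≤ ∏ i, rwDens σ y (zs i) := Finset.prod_nonneg fun i _ => hq _ _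
          have hm := min_div_le hw (gbWeight_pos y x)
            (S := ∑ i, gbWeight d y (zs i)) (Nat.cast_nonneg n) ht hκ hM hnM
            (Finset.sum_nonneg fun i _ => hW x (ys i) : 0 ≤ ∑ i, gbWeight d x (ys i))
          refine (mul_le_mul_of_nonneg_right (a := _ * _)
            ((congrArg₂ min rfl (by rw [accRatio_eq_inv hσ])).trans_le hm)
            (mul_nonneg hQ hZ)).trans_eq ?_
          simp only [Finset.prod_mul_distrib]
          rw [← Real.exp_sum, Finset.sum_neg_distrib, ← Finset.sum_div]
          ring
      _ = (w⁻¹ * ∏ i, rwDens σ x (ys i)) * (4 / (κ * t) + n * Real.exp (κ * M / 2) *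
            (∫ z, Real.exp (-(gbWeight d y z / t)) * rwDens σ y z) ^ (n - 1)) := by
          rw [integral_const_mul, integral_add (i1.const_mul _) (i2.const_mul _),
            integral_const_mul, integral_const_mul,
            integral_fintype_prod_volume_eq_pow (fun z => rwDens σ y z),
            integral_fintype_prod_volume_eq_pow
              (fun z => Real.exp (-(gbWeight d y z / t)) * rwDens σ y z), integral_rwDens hσ]
          simp
      _ ≤ (w⁻¹ * ∏ i, rwDens σ x (ys i)) * (4 / (κ * t) + n * Real.exp (κ * M / 2) *
            Real.exp (-κ) ^ (n - 1)) := by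
          gcongr
          exact integral_nonneg fun z => mul_nonneg (Real.exp_pos _).le (hq _ _)
      _ = w⁻¹ * K * ∏ i, rwDens σ x (ys i) := by
          rw [← Real.exp_nat_mul, mul_assoc (n : ℝ), ← Real.exp_add, ← hM_def,
            show κ * M / 2 + M * -κ = -(κ / 2 * M) by ring]
          ring
  have houter : ∫ ys, ∫ zs, F ys zs ≤ w⁻¹ * K := by
    have i1 : Integrable (fun ys : Fin (n - 1) → Ed d => ∏ i, rwDens σ x (ys i)) :=
      Integrable.fintype_prod fun _ => integrable_rwDens hσ x
    refine (integral_mono_of_nonneg (.of_forall fun ys => integral_nonneg (hF0 ys))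
      (i1.const_mul _) (.of_forall hinner)).trans_eq ?_
    rw [integral_const_mul, integral_fintype_prod_volume_eq_pow (fun z => rwDens σ x z),
      integral_rwDens hσ, one_pow, mul_one]
  calc pMTM d σ n x y = rwDens σ x y * w * ∫ ys, ∫ zs, F ys zs := rfl
    _ ≤ rwDens σ x y * w * (w⁻¹ * K) :=
        mul_le_mul_of_nonneg_left houter (mul_nonneg (hq _ _) hw.le)
    _ = rwDens σ x y * K := by
        field_simp
    _ = _ := by
        have : 4 / (κ * t) = 4 / κ * Real.exp 5 * Real.exp (-‖y‖) := by
          rw [mul_assoc, ← Real.exp_add, show (5 : ℝ) + -‖y‖ = -(‖y‖ - 5) by ring, Real.exp_neg,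
            ← ht_def]
          field_simp
        rw [← this]

/-- The escape mass from `x`, weighted by the target density at `x`. -/
lemma exists_lintegral_pMTM_le (d : ℕ) {σ : ℝ} (hσ : 0 < σ) :
    ∃ κ C : ℝ, 0 < κ ∧ 0 ≤ C ∧ ∀ n : ℕ, 2 ≤ n → ∀ x : Ed d,
      ∫⁻ y, ENNReal.ofReal (pMTM d σ n x y * stdGauss d x) ≤
        ENNReal.ofReal (C * Real.exp (-‖x‖) + n * Real.exp (-(κ * (n - 1 : ℕ)))) *
          ENNReal.ofReal (stdGauss d x) := by
  obtain ⟨κ, C, hκ, hC, H⟩ := exists_pMTM_le d hσ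
  set I := ∫ v : Ed d, rwDens σ 0 v * Real.exp ‖v‖ with hI
  have hI0 : 0 ≤ I := integral_nonneg fun v => mul_nonneg (rwDens_pos hσ _ _).le (Real.exp_pos _).le
  refine ⟨κ, C * I, hκ, by positivity, fun n hn x => ?_⟩
  have hπ := stdGauss_pos x
  set e := (n : ℝ) * Real.exp (-(κ * (n - 1 : ℕ)))
  have he : 0 ≤ e := by positivity
  have i1 : Integrable fun y : Ed d => rwDens σ x y * Real.exp ‖y - x‖ := by
    simpa only [← rwDens_eq_sub] using (integrable_rwDens_mul_exp_norm (d := d) hσ).comp_sub_right x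
  have hi1 : ∫ y : Ed d, rwDens σ x y * Real.exp ‖y - x‖ = I := by
    rw [hI, ← integral_sub_right_eq_self (fun v : Ed d => rwDens σ 0 v * Real.exp ‖v‖) x]
    simp only [← rwDens_eq_sub]
  set g : Ed d → ℝ := fun y =>
    (C * Real.exp (-‖x‖)) * (rwDens σ x y * Real.exp ‖y - x‖) + e * rwDens σ x y with hg
  have hgi : Integrable g := (i1.const_mul _).add ((integrable_rwDens hσ x).const_mul _)
  have hg0 : ∀ y, 0 ≤ g y := fun y => by
    have := rwDens_pos hσ x y
    rw [hg]
    positivity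
  have hgint : ∫ y, g y = C * I * Real.exp (-‖x‖) + e := by
    rw [hg, integral_add (i1.const_mul _) ((integrable_rwDens hσ x).const_mul _),
      integral_const_mul, integral_const_mul, hi1, integral_rwDens hσ]
    ring
  have hle : ∀ y, pMTM d σ n x y ≤ g y := fun y => by
    refine (H n hn x y).trans ?_
    have hq := rwDens_pos hσ x y
    have h1 : Real.exp (-‖y‖) ≤ Real.exp (-‖x‖) * Real.exp ‖y - x‖ := by
      rw [← Real.exp_add, Real.exp_le_exp]
      have := norm_le_norm_add_norm_sub y x
      linarith
    calc rwDens σ x y * (C * Real.exp (-‖y‖) + e)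
        ≤ rwDens σ x y * (C * (Real.exp (-‖x‖) * Real.exp ‖y - x‖) + e) := by gcongr
      _ = g y := by
        rw [hg]
        ring
  calc ∫⁻ y, ENNReal.ofReal (pMTM d σ n x y * stdGauss d x)
      ≤ ∫⁻ y, ENNReal.ofReal (g y) * ENNReal.ofReal (stdGauss d x) := by
        refine lintegral_mono fun y => ?_
        rw [← ENNReal.ofReal_mul (hg0 y)]
        exact ENNReal.ofReal_le_ofReal (mul_le_mul_of_nonneg_right (hle y) hπ.le)
    _ = _ := by
        rw [lintegral_mul_const' _ _ ENNReal.ofReal_ne_top,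
          ← ofReal_integral_eq_lintegral_ofReal hgi (.of_forall hg0), hgint]

lemma integrable_stdGauss : Integrable (stdGauss d) := by
  have h := (integrable_exp_neg_mul_norm_sq (d := d) (b := 1 / 2) (by norm_num)).const_mul
    ((2 * Real.pi) ^ (-(d : ℝ) / 2))
  refine h.congr (.of_forall fun x => ?_)
  simp only [stdGauss]
  congr 2
  ring

/-- The Gaussian mass outside large balls vanishes. -/
lemma tendsto_setLIntegral_compl_closedBall :
    Tendsto (fun R : ℕ => ∫⁻ x in (Metric.closedBall (0 : Ed d) R)ᶜ,
      ENNReal.ofReal (stdGauss d x)) atTop (nhds 0) := by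
  have hfin : ∫⁻ x, ENNReal.ofReal (stdGauss d x) ≠ ∞ :=
    (integrable_stdGauss (d := d)).lintegral_lt_top.ne
  have hμ : IsFiniteMeasure
      ((volume : Measure (Ed d)).withDensity fun x => ENNReal.ofReal (stdGauss d x)) :=
    isFiniteMeasure_withDensity hfin
  have h := tendsto_measure_iInter_atTop
    (μ := (volume : Measure (Ed d)).withDensity fun x => ENNReal.ofReal (stdGauss d x))
    (s := fun R : ℕ => (Metric.closedBall (0 : Ed d) R)ᶜ)
    (fun R => measurableSet_closedBall.compl.nullMeasurableSet)
    (fun a b hab => Set.compl_subset_compl.mpr (Metric.closedBall_subset_closedBall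
      (Nat.cast_le.mpr hab)))
    ⟨0, measure_ne_top _ _⟩
  rw [← Set.compl_iUnion, Metric.iUnion_closedBall_nat, Set.compl_univ, measure_empty] at h
  exact h.congr fun R => withDensity_apply _ measurableSet_closedBall.compl

lemma setLIntegral_compl_closedBall_pos (hd : 1 ≤ d) (R : ℝ) :
    0 < ∫⁻ x in (Metric.closedBall (0 : Ed d) R)ᶜ, ENNReal.ofReal (stdGauss d x) := by
  have : Nonempty (Fin d) := ⟨⟨0, hd⟩⟩
  rw [setLIntegral_pos_iff (continuous_stdGauss.measurable.ennreal_ofReal)]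
  have hs : Function.support (fun x : Ed d => ENNReal.ofReal (stdGauss d x)) = Set.univ :=
    Set.eq_univ_of_forall fun x => by simp [stdGauss_pos x]
  rw [hs, Set.univ_inter]
  refine Metric.isClosed_closedBall.isOpen_compl.measure_pos _ ?_
  obtain ⟨x, hx⟩ := NormedSpace.exists_lt_norm ℝ (Ed d) R
  exact ⟨x, by simpa using hx⟩

/-- With globally balanced weights `w(x,y) = π(y)/π(x)`, standard Gaussian target
and Gaussian random-walk proposals, the conductance of the Multiple-try Metropolis
kernel vanishes as the number of proposals `n → ∞`. -/
theorem gb_mtm_conductance_vanishes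
    (d : ℕ) (hd : 1 ≤ d) (σ : ℝ) (hσ : 0 < σ) :
    Tendsto (fun n : ℕ => conductance (stdGauss d) (pMTM d σ n)) atTop (nhds 0) := by
  obtain ⟨κ, C, hκ, hC, H⟩ := exists_lintegral_pMTM_le d hσ
  refine ENNReal.tendsto_nhds_zero.mpr fun ε hε => ?_
  have h1 : Tendsto (fun R : ℕ => ENNReal.ofReal (C * Real.exp (-(R : ℝ)))) atTop (nhds 0) := by
    have h : Tendsto (fun R : ℕ => C * Real.exp (-(R : ℝ))) atTop (nhds (C * 0)) :=
      (Real.tendsto_exp_neg_atTop_nhds_zero.comp tendsto_natCast_atTop_atTop).const_mul C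
    rw [mul_zero] at h
    simpa using ENNReal.tendsto_ofReal h
  have h2 : Tendsto (fun n : ℕ => ENNReal.ofReal (n * Real.exp (-(κ * (n - 1 : ℕ))))) atTop
      (nhds 0) := by
    have h : Tendsto (fun n : ℕ => Real.exp κ * ((n : ℝ) ^ (1 : ℝ) * Real.exp (-κ * n))) atTop
        (nhds (Real.exp κ * 0)) :=
      ((tendsto_rpow_mul_exp_neg_mul_atTop_nhds_zero 1 κ hκ).comp
        tendsto_natCast_atTop_atTop).const_mul _
    rw [mul_zero] at h
    have h' : Tendsto (fun n : ℕ => (n : ℝ) * Real.exp (-(κ * (n - 1 : ℕ)))) atTop (nhds 0) := by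
      refine h.congr' ?_
      filter_upwards [eventually_ge_atTop 1] with n hn
      rw [Real.rpow_one, Nat.cast_sub hn, Nat.cast_one,
        show -(κ * ((n : ℝ) - 1)) = κ + -κ * n by ring, Real.exp_add]
      ring
    simpa using ENNReal.tendsto_ofReal h'
  have hε2 : 0 < ε / 2 := ENNReal.half_pos hε.ne'
  obtain ⟨R, hR1, hR2⟩ := ((h1.eventually_le_const hε2).and
    ((tendsto_setLIntegral_compl_closedBall (d := d)).eventually_le_const
      (by simp : (0 : ℝ≥0∞) < 1 / 2))).exists
  filter_upwards [h2.eventually_le_const hε2, eventually_ge_atTop 2] with n hn hn2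
  set A : Set (Ed d) := (Metric.closedBall (0 : Ed d) R)ᶜ with hA
  have hAm : MeasurableSet A := measurableSet_closedBall.compl
  have hpos := setLIntegral_compl_closedBall_pos hd (R : ℝ)
  refine (iInf₂_le A ⟨hAm, hpos, hR2⟩).trans (ENNReal.div_le_of_le_mul ?_)
  rw [← lintegral_const_mul _ (continuous_stdGauss.measurable.ennreal_ofReal)]
  refine setLIntegral_mono' hAm fun x hx => ?_
  refine (setLIntegral_le_lintegral _ _).trans ((H n hn2 x).trans ?_)
  gcongr
  have hx' : (R : ℝ) ≤ ‖x‖ := by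
    have : (R : ℝ) < ‖x‖ := by simpa [hA] using hx
    exact this.le
  calc ENNReal.ofReal (C * Real.exp (-‖x‖) + n * Real.exp (-(κ * (n - 1 : ℕ))))
      ≤ ENNReal.ofReal (C * Real.exp (-‖x‖)) +
        ENNReal.ofReal (n * Real.exp (-(κ * (n - 1 : ℕ)))) := ENNReal.ofReal_add_le
    _ ≤ ENNReal.ofReal (C * Real.exp (-(R : ℝ))) +
        ENNReal.ofReal (n * Real.exp (-(κ * (n - 1 : ℕ)))) := by gcongr
    _ ≤ ε / 2 + ε / 2 := add_le_add hR1 hn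
    _ = ε := ENNReal.add_halves ε

end
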